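/- Let n ≥ 0, let z ∈ ℝ with z ∉ {1−p, 1+p}, and let f : {0,…,3^n} → ℝ satisfy Δ_n f = R(z)·f. Then the spectral-decimation extension g : {0,…,3^{n+1}} → ℝ of f with parameter z satisfies Δ_{n+1} g = z·g. -/

import Mathlib

noncomputable section

/-- Transition coefficients `a_{n,k}`: `a_{n+1,3k} = a_{n,k}`, `a_{n+1,3k+1} = q = 1-p`,
`a_{n+1,3k+2} = p`. -/
def a (p : ℝ) : ℕ → ℕ → ℝ
  | 0, _ => 0
  | n + 1, k =>
    if k % 3 = 1 then 1 - p
    else if k % 3 = 2 then p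
    else a p n (k / 3)

/-- The Neumann discrete Laplacian `Δ_n`. -/
def lap (p : ℝ) (n : ℕ) (f : ℕ → ℝ) (k : ℕ) : ℝ :=
  if k = 0 then f 0 - f 1
  else if k = 3 ^ n then f (3 ^ n) - f (3 ^ n - 1)
  else f k - a p n k * f (k - 1) - (1 - a p n k) * f (k + 1)

/-- The cubic polynomial `R(z) = z(z² − 3z + 2 + pq)/(pq)` with `q = 1 − p`. -/
def R (p z : ℝ) : ℝ := z * (z ^ 2 - 3 * z + 2 + p * (1 - p)) / (p * (1 - p))

/-- The spectral-decimation extension with parameter `z` of a function on `{0,…,3^n}`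
to a function on `{0,…,3^{n+1}}`:  `g(3k) = f(k)`,
`g(3k+1) = (q(1−z)f(k) + pq f(k+1))/((1−p−z)(1+p−z))`,
`g(3k+2) = (q(1−z)f(k+1) + pq f(k))/((1−p−z)(1+p−z))`. -/
def sdExt (p z : ℝ) (f : ℕ → ℝ) (m : ℕ) : ℝ :=
  if m % 3 = 0 then f (m / 3)
  else if m % 3 = 1 then
    ((1 - p) * (1 - z) * f (m / 3) + p * (1 - p) * f (m / 3 + 1)) /
      ((1 - p - z) * (1 + p - z))
  else
    ((1 - p) * (1 - z) * f (m / 3 + 1) + p * (1 - p) * f (m / 3)) /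
      ((1 - p - z) * (1 + p - z))

theorem sdExt_three_mul (p z : ℝ) (f : ℕ → ℝ) (k : ℕ) : sdExt p z f (3 * k) = f k := by
  simp [sdExt]

theorem sdExt_three_mul_add_one (p z : ℝ) (f : ℕ → ℝ) (k : ℕ) :
    sdExt p z f (3 * k + 1) = ((1 - p) * (1 - z) * f k + p * (1 - p) * f (k + 1)) /
      ((1 - p - z) * (1 + p - z)) := by
  have h1 : (3 * k + 1) % 3 = 1 := by omega
  have h2 : (3 * k + 1) / 3 = k := by omega
  simp [sdExt, h1, h2]

theorem sdExt_three_mul_add_two (p z : ℝ) (f : ℕ → ℝ) (k : ℕ) :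
    sdExt p z f (3 * k + 2) = ((1 - p) * (1 - z) * f (k + 1) + p * (1 - p) * f k) /
      ((1 - p - z) * (1 + p - z)) := by
  have h1 : (3 * k + 2) % 3 = 2 := by omega
  have h2 : (3 * k + 2) / 3 = k := by omega
  simp [sdExt, h1, h2]

theorem a_succ_three_mul (p : ℝ) (n k : ℕ) : a p (n + 1) (3 * k) = a p n k := by
  simp [a]

theorem a_succ_three_mul_add_one (p : ℝ) (n k : ℕ) : a p (n + 1) (3 * k + 1) = 1 - p := by
  have h : (3 * k + 1) % 3 = 1 := by omega
  simp [a, h]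

theorem a_succ_three_mul_add_two (p : ℝ) (n k : ℕ) : a p (n + 1) (3 * k + 2) = p := by
  have h : (3 * k + 2) % 3 = 2 := by omega
  simp [a, h]

theorem lap_zero_right (p : ℝ) (n : ℕ) (f : ℕ → ℝ) : lap p n f 0 = f 0 - f 1 := by
  simp [lap]

theorem lap_three_pow (p : ℝ) (n : ℕ) (f : ℕ → ℝ) :
    lap p n f (3 ^ n) = f (3 ^ n) - f (3 ^ n - 1) := by
  simp [lap]

theorem lap_of_ne (p : ℝ) (n : ℕ) (f : ℕ → ℝ) {k : ℕ} (h0 : k ≠ 0) (h1 : k ≠ 3 ^ n) :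
    lap p n f k = f k - a p n k * f (k - 1) - (1 - a p n k) * f (k + 1) := by
  simp [lap, h0, h1]

/-- If `x - y = R(z)·x`, where `y` is the average of `f` over the neighbours of a coarse vertex with
value `x`, then the extended values satisfy the eigenvalue equation with eigenvalue `z` there. -/
theorem sub_div_eq_of_sub_eq_R_mul {p z x y : ℝ} (hp : p ≠ 0) (hq : 1 - p ≠ 0)
    (h1 : 1 - p - z ≠ 0) (h2 : 1 + p - z ≠ 0) (h : x - y = R p z * x) :
    x - ((1 - p) * (1 - z) * x + p * (1 - p) * y) / ((1 - p - z) * (1 + p - z)) = z * x := by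
  obtain rfl : y = x - R p z * x := by linarith
  unfold R
  field_simp
  ring

/-- If `Δ_n f = R(z)·f` and `z ∉ {1−p, 1+p}`, then the spectral-decimation extension `g`
of `f` with parameter `z` satisfies `Δ_{n+1} g = z·g`. -/
theorem stmt3 (p : ℝ) (hp0 : 0 < p) (hp1 : p < 1) (n : ℕ) (z : ℝ)
    (hz1 : z ≠ 1 - p) (hz2 : z ≠ 1 + p) (f : ℕ → ℝ)
    (hf : ∀ k ≤ 3 ^ n, lap p n f k = R p z * f k) :
    ∀ m ≤ 3 ^ (n + 1), lap p (n + 1) (sdExt p z f) m = z * sdExt p z f m := by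
  have hp : p ≠ 0 := hp0.ne'
  have hq : 1 - p ≠ 0 := by linarith
  have h1 : 1 - p - z ≠ 0 := fun h => hz1 (by linarith)
  have h2 : 1 + p - z ≠ 0 := fun h => hz2 (by linarith)
  intro m hm
  have hpow : 3 ^ (n + 1) = 3 * 3 ^ n := by ring
  obtain ⟨k, rfl | rfl | rfl⟩ : ∃ k, m = 3 * k ∨ m = 3 * k + 1 ∨ m = 3 * k + 2 :=
    ⟨m / 3, by omega⟩
  · have hk := hf k (by omega)
    rcases Nat.eq_zero_or_pos k with rfl | hk0
    · rw [lap_zero_right] at hk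
      have e1 := sdExt_three_mul_add_one p z f 0
      have e0 := sdExt_three_mul p z f 0
      simp only [mul_zero, zero_add] at e1 e0 ⊢
      rw [lap_zero_right, e0, e1]
      exact sub_div_eq_of_sub_eq_R_mul hp hq h1 h2 hk
    · obtain ⟨j, rfl⟩ : ∃ j, k = j + 1 := ⟨k - 1, by omega⟩
      have hpred : 3 * (j + 1) - 1 = 3 * j + 2 := by omega
      by_cases hkn : j + 1 = 3 ^ n
      · rw [hkn, lap_three_pow, ← hkn, Nat.add_sub_cancel] at hk
        rw [hkn, ← hpow, lap_three_pow, hpow, ← hkn, hpred, sdExt_three_mul,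
          sdExt_three_mul_add_two]
        exact sub_div_eq_of_sub_eq_R_mul hp hq h1 h2 hk
      · rw [lap_of_ne _ _ _ (by omega) hkn, Nat.add_sub_cancel, sub_sub] at hk
        rw [lap_of_ne _ _ _ (by omega) (by omega), a_succ_three_mul, hpred, sdExt_three_mul,
          sdExt_three_mul_add_one, sdExt_three_mul_add_two,
          ← sub_div_eq_of_sub_eq_R_mul hp hq h1 h2 hk]
        ring
  · rw [lap_of_ne _ _ _ (by omega) (by omega), a_succ_three_mul_add_one, Nat.add_sub_cancel,
      sdExt_three_mul, sdExt_three_mul_add_one, sdExt_three_mul_add_two]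
    field_simp
    ring
  · have e : 3 * k + 2 + 1 = 3 * (k + 1) := by ring
    have e' : 3 * k + 2 - 1 = 3 * k + 1 := by omega
    rw [lap_of_ne _ _ _ (by omega) (by omega), a_succ_three_mul_add_two, e, e',
      sdExt_three_mul, sdExt_three_mul_add_one, sdExt_three_mul_add_two]
    field_simp
    ring
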